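/- A root oscillates by less than one across adjacent facets: if s and b are facets with s contained in the closure of b, then for every r ∈ R, every p ∈ s and every q ∈ b one has |r(q) − r(p)| < 1. -/

import Mathlib

open Set

/-- The set of affine roots `(r, n)` with `r ∈ R`, `n : ℤ`, vanishing at the point `x`,
i.e. such that `r x + n = 0`.  This is the set `Y_x`. -/
def affineRootsVanishingAt {V : Type*} [NormedAddCommGroup V] [NormedSpace ℝ V]
    (R : Finset (V →ₗ[ℝ] ℝ)) (x : V) : Set ((V →ₗ[ℝ] ℝ) × ℤ) :=
  {α | α.1 ∈ R ∧ α.1 x + (α.2 : ℝ) = 0}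

/-- `H_n`: the set of points where exactly `n` affine roots vanish. -/
def Hset {V : Type*} [NormedAddCommGroup V] [NormedSpace ℝ V]
    (R : Finset (V →ₗ[ℝ] ℝ)) (n : ℕ) : Set V :=
  {x | (affineRootsVanishingAt R x).ncard = n}

/-- A facet is a connected component of some `H_n`. -/
def IsFacet {V : Type*} [NormedAddCommGroup V] [NormedSpace ℝ V]
    (R : Finset (V →ₗ[ℝ] ℝ)) (σ : Set V) : Prop :=
  ∃ (n : ℕ) (x : V), x ∈ Hset R n ∧ σ = connectedComponentIn (Hset R n) x

open Topology in
/-- Near `a`, a real number is an integer only if it equals `a`. -/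
theorem eventually_intCast_eq_imp_eq (a : ℝ) :
    ∀ᶠ z : ℝ in 𝓝 a, ∀ m : ℤ, z = m → a = m := by
  have hclosed : IsClosed (((↑) : ℤ → ℝ) '' {m : ℤ | a ≠ m}) :=
    Int.isClosedEmbedding_coe_real.isClosedMap _ (isClosed_discrete _)
  have ha : a ∈ (((↑) : ℤ → ℝ) '' {m : ℤ | a ≠ m})ᶜ := by
    rintro ⟨m, hm, h⟩
    exact hm h.symm
  filter_upwards [hclosed.isOpen_compl.mem_nhds ha] with z hz m hm
  by_contra h
  exact hz ⟨m, h, hm.symm⟩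

section AffineRoots

variable {V : Type*} [NormedAddCommGroup V] [NormedSpace ℝ V]

theorem affineRootsVanishingAt_finite (R : Finset (V →ₗ[ℝ] ℝ)) (x : V) :
    (affineRootsVanishingAt R x).Finite := by
  refine Set.Finite.of_finite_image (f := Prod.fst)
    (R.finite_toSet.subset ?_) ?_
  · rintro _ ⟨α, hα, rfl⟩
    exact hα.1
  · rintro ⟨r, n⟩ ⟨_, h⟩ ⟨r', n'⟩ ⟨_, h'⟩ (rfl : r = r')
    have : (n : ℝ) = n' := by simp only at h h'; linarith
    rw [Int.cast_injective this]

open Topology in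
theorem eventually_affineRootsVanishingAt_subset [FiniteDimensional ℝ V]
    (R : Finset (V →ₗ[ℝ] ℝ)) (x : V) :
    ∀ᶠ y in 𝓝 x, affineRootsVanishingAt R y ⊆ affineRootsVanishingAt R x := by
  have h : ∀ᶠ y in 𝓝 x, ∀ r ∈ R, ∀ m : ℤ, r y = m → r x = m :=
    (Filter.eventually_all_finset R).2 fun r _ =>
      r.continuous_of_finiteDimensional.continuousAt.eventually
        (eventually_intCast_eq_imp_eq (r x))
  filter_upwards [h] with y hy
  rintro ⟨r, n⟩ ⟨hr, hn⟩
  refine ⟨hr, ?_⟩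
  have := hy r hr (-n) (by push_cast; simp only at hn; linarith)
  push_cast at this
  simp only
  linarith

/-- The vanishing affine roots are the same at all points of a facet. -/
theorem IsFacet.affineRootsVanishingAt_eq [FiniteDimensional ℝ V]
    {R : Finset (V →ₗ[ℝ] ℝ)} {b : Set V} (hb : IsFacet R b) {x y : V}
    (hx : x ∈ b) (hy : y ∈ b) :
    affineRootsVanishingAt R x = affineRootsVanishingAt R y := by
  obtain ⟨n, x₀, -, rfl⟩ := hb
  have hsub := connectedComponentIn_subset (Hset R n) x₀
  refine isPreconnected_connectedComponentIn.induction₂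
    (fun x y => affineRootsVanishingAt R x = affineRootsVanishingAt R y)
    (fun x hx => ?_) (fun _ _ _ _ _ _ => Eq.trans) (fun _ _ _ _ => Eq.symm) hx hy
  filter_upwards [nhdsWithin_le_nhds (eventually_affineRootsVanishingAt_subset R x),
    self_mem_nhdsWithin] with y hy hyb
  have hxn : (affineRootsVanishingAt R x).ncard = n := hsub hx
  have hyn : (affineRootsVanishingAt R y).ncard = n := hsub hyb
  exact (Set.eq_of_subset_of_ncard_le hy (hxn.trans hyn.symm).le
    (affineRootsVanishingAt_finite R x)).symm

theorem IsFacet.isPreconnected {R : Finset (V →ₗ[ℝ] ℝ)} {b : Set V} (hb : IsFacet R b) :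
    IsPreconnected b := by
  obtain ⟨n, x₀, -, rfl⟩ := hb
  exact isPreconnected_connectedComponentIn

/-- A root taking an integer value at a point of a facet is constant on that facet. -/
theorem IsFacet.eq_intCast [FiniteDimensional ℝ V]
    {R : Finset (V →ₗ[ℝ] ℝ)} {b : Set V} (hb : IsFacet R b) {r : V →ₗ[ℝ] ℝ} (hr : r ∈ R)
    {x y : V} (hx : x ∈ b) (hy : y ∈ b) {m : ℤ} (hm : r x = m) : r y = m := by
  have hmem : (r, -m) ∈ affineRootsVanishingAt R x := ⟨hr, by simp [hm]⟩
  rw [hb.affineRootsVanishingAt_eq hx hy] at hmem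
  have := hmem.2
  push_cast at this
  linarith

end AffineRoots

theorem root_oscillation_lt_one_adjacent_facets {V : Type*} [NormedAddCommGroup V] [NormedSpace ℝ V] [FiniteDimensional ℝ V]
    (R : Finset (V →ₗ[ℝ] ℝ)) (hR : ∀ r ∈ R, r ≠ 0)
    (s b : Set V) (hs : IsFacet R s) (hb : IsFacet R b) (hsb : s ⊆ closure b)
    (r : V →ₗ[ℝ] ℝ) (hr : r ∈ R) :
    ∀ p ∈ s, ∀ q ∈ b, |r q - r p| < 1 := by
  intro p hp q hq
  have hcont : Continuous r := r.continuous_of_finiteDimensional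
  have hpb := hsb hp
  by_cases hint : ∃ m : ℤ, r q = m
  · obtain ⟨m, hm⟩ := hint
    have hpm : r p = m :=
      closure_minimal (t := {y | r y = m}) (fun y hy => hb.eq_intCast hr hq hy hm)
        (isClosed_eq hcont continuous_const) hpb
    simp [hm, hpm]
  · have hne : ∀ y ∈ b, ∀ m : ℤ, r y ≠ m := fun y hy m hm =>
      hint ⟨m, hb.eq_intCast hr hy hq hm⟩
    have hord := (hb.isPreconnected.image r hcont.continuousOn).ordConnected
    have hfl := Int.floor_le (r q)
    have hlt := Int.lt_floor_add_one (r q)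
    have hfl' := lt_of_le_of_ne hfl (hne q hq _).symm
    have hsub : b ⊆ {y | r y ∈ Set.Icc (⌊r q⌋ : ℝ) (⌊r q⌋ + 1)} := by
      intro y hy
      constructor
      · by_contra! hlow
        obtain ⟨z, hz, hzm⟩ := hord.out (Set.mem_image_of_mem r hy)
          (Set.mem_image_of_mem r hq) ⟨hlow.le, hfl⟩
        exact hne z hz _ hzm
      · by_contra! hhigh
        obtain ⟨z, hz, hzm⟩ := hord.out (Set.mem_image_of_mem r hq)
          (Set.mem_image_of_mem r hy) ⟨hlt.le, hhigh.le⟩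
        exact hne z hz (⌊r q⌋ + 1) (by push_cast; exact hzm)
    obtain ⟨h₁, h₂⟩ := closure_minimal hsub (isClosed_Icc.preimage hcont) hpb
    rw [abs_lt]
    constructor <;> linarith
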